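/- arXiv:2409.14694 — 2 statements merged into one kernel-verified Lean document; each statement's English description precedes it below -/
import Mathlib

section
/- For every integer k ≥ 0 and n = 4k + 3, the star graph on 3(n+1)²/8 = 6(k+1)² vertices is a vertex-minor of the n×n grid graph. -/
/-- A finite simple graph with an explicit vertex set inside an ambient type `α`. -/
structure FGraph (α : Type*) where
  verts : Set α
  Adj : α → α → Prop
  symm : ∀ {a b}, Adj a b → Adj b a
  loopless : ∀ a, ¬ Adj a a
  edge_mem : ∀ {a b}, Adj a b → a ∈ verts ∧ b ∈ verts

namespace FGraph

variable {α : Type*}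

/-- Local complementation at `v`: two distinct vertices are adjacent iff exactly one of
(adjacent in `G`) or (both neighbours of `v` in `G`) holds. -/
def LC (G : FGraph α) (v : α) : FGraph α where
  verts := G.verts
  Adj a b := a ≠ b ∧ Xor' (G.Adj a b) (G.Adj v a ∧ G.Adj v b)
  symm := by
    rintro a b ⟨hne, h⟩
    refine ⟨hne.symm, ?_⟩
    rcases h with ⟨h1, h2⟩ | ⟨h1, h2⟩
    · exact Or.inl ⟨G.symm h1, fun hx => h2 ⟨hx.2, hx.1⟩⟩
    · exact Or.inr ⟨⟨h1.2, h1.1⟩, fun hx => h2 (G.symm hx)⟩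
  loopless := fun a h => h.1 rfl
  edge_mem := by
    rintro a b ⟨hne, h⟩
    rcases h with ⟨h1, _⟩ | ⟨⟨ha, hb⟩, _⟩
    · exact G.edge_mem h1
    · exact ⟨(G.edge_mem ha).2, (G.edge_mem hb).2⟩

/-- Z measurement at `v`: delete the vertex `v` together with all incident edges. -/
def ZM (G : FGraph α) (v : α) : FGraph α where
  verts := G.verts \ {v}
  Adj a b := G.Adj a b ∧ a ≠ v ∧ b ≠ v
  symm := fun h => ⟨G.symm h.1, h.2.2, h.2.1⟩
  loopless := fun a h => G.loopless a h.1
  edge_mem := by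
    rintro a b ⟨h, ha, hb⟩
    exact ⟨⟨(G.edge_mem h).1, ha⟩, ⟨(G.edge_mem h).2, hb⟩⟩

/-- X measurement at `u` with chosen neighbour `w`:
`X_u(G) = LC_w(Z_u(LC_u(LC_w(G))))`. -/
def XM (G : FGraph α) (u w : α) : FGraph α :=
  ((((G.LC w).LC u).ZM u).LC w)

/-- Y measurement at `v`: `Y_v(G) = Z_v(LC_v(G))`. -/
def YM (G : FGraph α) (v : α) : FGraph α :=
  (G.LC v).ZM v

/-- `G` is a star graph with centre `c`. -/
def IsStar (G : FGraph α) (c : α) : Prop :=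
  c ∈ G.verts ∧
    ∀ a b, G.Adj a b ↔ (a ≠ b ∧ a ∈ G.verts ∧ b ∈ G.verts ∧ (a = c ∨ b = c))

/-- `G` is a complete graph on its vertex set. -/
def IsComplete (G : FGraph α) : Prop :=
  ∀ a b, G.Adj a b ↔ (a ≠ b ∧ a ∈ G.verts ∧ b ∈ G.verts)

/-- One step of local complementation or vertex deletion. -/
inductive Step : FGraph α → FGraph α → Prop
  | lc (G : FGraph α) (v : α) : Step G (G.LC v)
  | del (G : FGraph α) (v : α) : Step G (G.ZM v)

/-- `H` is a vertex-minor of `G`: `H` is obtained from `G` by a finite sequence of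
local complementations and vertex deletions. -/
def IsVertexMinor (H G : FGraph α) : Prop :=
  Relation.ReflTransGen Step G H

/-- One step of local complementation. -/
inductive LCStep : FGraph α → FGraph α → Prop
  | lc (G : FGraph α) (v : α) : LCStep G (G.LC v)

/-- `H` is obtained from `G` by a finite sequence of local complementations. -/
def LCReach (G H : FGraph α) : Prop :=
  Relation.ReflTransGen LCStep G H

end FGraph

/-- The `n × n` grid graph: vertices `{0,…,n-1} × {0,…,n-1}`, two vertices being
adjacent iff they agree in one coordinate and differ by exactly 1 in the other. -/
def gridGraph (n : ℕ) : FGraph (ℕ × ℕ) where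
  verts := {p | p.1 < n ∧ p.2 < n}
  Adj p q := p.1 < n ∧ p.2 < n ∧ q.1 < n ∧ q.2 < n ∧
    ((p.1 = q.1 ∧ (p.2 + 1 = q.2 ∨ q.2 + 1 = p.2)) ∨
     (p.2 = q.2 ∧ (p.1 + 1 = q.1 ∨ q.1 + 1 = p.1)))
  symm := by
    rintro p q ⟨h1, h2, h3, h4, (⟨he, hd⟩ | ⟨he, hd⟩)⟩
    · exact ⟨h3, h4, h1, h2, Or.inl ⟨he.symm, hd.symm⟩⟩
    · exact ⟨h3, h4, h1, h2, Or.inr ⟨he.symm, hd.symm⟩⟩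
  loopless := by
    rintro p ⟨_, _, _, _, (⟨_, hd⟩ | ⟨_, hd⟩)⟩ <;> omega
  edge_mem := by
    rintro p q ⟨h1, h2, h3, h4, _⟩
    exact ⟨⟨h1, h2⟩, ⟨h3, h4⟩⟩

namespace FGraph

variable {α : Type*}

theorem ext_of_iff {G H : FGraph α} (hv : ∀ a, a ∈ G.verts ↔ a ∈ H.verts)
    (ha : ∀ a b, G.Adj a b ↔ H.Adj a b) : G = H := by
  obtain ⟨V, A, _, _, _⟩ := G
  obtain ⟨V', A', _, _, _⟩ := H
  obtain rfl : V = V' := Set.ext hv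
  obtain rfl : A = A' := funext fun a => funext fun b => propext (ha a b)
  rfl

theorem XM_isVertexMinor (G : FGraph α) (u w : α) : IsVertexMinor (G.XM u w) G :=
  (((Relation.ReflTransGen.single (Step.lc G w)).tail (Step.lc _ u)).tail
    (Step.del _ u)).tail (Step.lc _ w)

/-- The subgraph induced on the complement of `D`. -/
def deleteSet (G : FGraph α) (D : Set α) : FGraph α where
  verts := G.verts \ D
  Adj a b := G.Adj a b ∧ a ∉ D ∧ b ∉ D
  symm := fun h => ⟨G.symm h.1, h.2.2, h.2.1⟩
  loopless := fun a h => G.loopless a h.1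
  edge_mem := fun h => ⟨⟨(G.edge_mem h.1).1, h.2.1⟩, ⟨(G.edge_mem h.1).2, h.2.2⟩⟩

theorem deleteSet_isVertexMinor (G : FGraph α) {D : Set α} (hD : D.Finite) :
    IsVertexMinor (G.deleteSet D) G := by
  induction D, hD using Set.Finite.induction_on with
  | empty =>
    have h : G.deleteSet ∅ = G := ext_of_iff (by simp [deleteSet]) (by simp [deleteSet])
    rw [h]
    exact Relation.ReflTransGen.refl
  | @insert v D _ _ ih =>
    have h : G.deleteSet (insert v D) = (G.deleteSet D).ZM v :=
      ext_of_iff (by simp [deleteSet, ZM]; tauto) (by simp [deleteSet, ZM]; tauto)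
    rw [h]
    exact Relation.ReflTransGen.tail ih (Step.del _ v)

/-- Measuring a degree-two vertex `w` between `c` and `u` moves the remaining neighbours of `u`
to `c` and turns `u` into a leaf at `c`. -/
theorem XM_adj_of_degree_two (G : FGraph α) {c w u : α}
    (hw : ∀ x, G.Adj w x ↔ x = c ∨ x = u) (hcu : c ≠ u) (hnadj : ¬ G.Adj c u)
    (hcommon : ∀ x, G.Adj c x → G.Adj u x → x = w) (a b : α) :
    (G.XM w u).Adj a b ↔ a ≠ w ∧ b ≠ w ∧ ((a = u ∧ b = c) ∨ (b = u ∧ a = c) ∨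
      (a ≠ u ∧ b ≠ u ∧ (G.Adj a b ∨ (a = c ∧ G.Adj u b) ∨ (b = c ∧ G.Adj u a)))) := by
  have symm : ∀ x y, G.Adj x y ↔ G.Adj y x := fun x y => ⟨G.symm, G.symm⟩
  have irr := G.loopless
  simp only [XM, LC, ZM, Xor']
  have h1 := hw a
  have h2 := hw b
  have h3 := hw c
  have h4 := hw u
  have h5 := hw w
  have h6 := hcommon a
  have h7 := hcommon b
  have s1 := symm a b
  have s2 := symm a c
  have s3 := symm a u
  have s4 := symm a w
  have s5 := symm b c
  have s6 := symm b u
  have s7 := symm b w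
  have s8 := symm c u
  have s9 := symm c w
  have s10 := symm u w
  have i1 := irr a
  have i2 := irr b
  have i3 := irr c
  have i4 := irr u
  have i5 := irr w
  clear hw hcommon symm irr
  by_cases a = w <;> by_cases b = w <;> by_cases a = u <;> by_cases b = u <;>
    by_cases a = c <;> by_cases b = c <;> grind

/-- The graph obtained from `G` by merging the vertices of `P ⊆ S` into the single centre `c`:
vertices outside `S` joining two members of `P` are gone, the other neighbours of `P` hang on `c`,
and the members of `P` other than `c` have become leaves at `c`. -/
def mergeInto (G : FGraph α) (S P : Set α) (c : α) : FGraph α where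
  verts := {x ∈ G.verts | x ∈ S ∨ ∀ p ∈ P, ∀ q ∈ P, G.Adj p x → G.Adj q x → p = q}
  Adj a b := (a ∈ G.verts ∧ (a ∈ S ∨ ∀ p ∈ P, ∀ q ∈ P, G.Adj p a → G.Adj q a → p = q)) ∧
    (b ∈ G.verts ∧ (b ∈ S ∨ ∀ p ∈ P, ∀ q ∈ P, G.Adj p b → G.Adj q b → p = q)) ∧ a ≠ b ∧
    (((a = c ∧ (b ∈ P ∨ b ∉ S ∧ ∃ p ∈ P, G.Adj p b)) ∨ (a ∈ S ∧ a ∉ P ∧ G.Adj a b)) ∨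
     ((b = c ∧ (a ∈ P ∨ a ∉ S ∧ ∃ p ∈ P, G.Adj p a)) ∨ (b ∈ S ∧ b ∉ P ∧ G.Adj b a)))
  symm := fun h => ⟨h.2.1, h.1, h.2.2.1.symm, h.2.2.2.symm⟩
  loopless := fun _ h => h.2.2.1 rfl
  edge_mem := fun h => ⟨h.1, h.2.1⟩

theorem mergeInto_singleton (G : FGraph α) {S : Set α} {c : α}
    (hbip : ∀ a b, G.Adj a b → (a ∈ S ↔ b ∉ S)) : G.mergeInto S {c} c = G := by
  refine ext_of_iff (fun a => ?_) (fun a b => ?_)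
  · simp [mergeInto]
  · have h1 := hbip a b
    have h2 := @G.edge_mem a b
    have h3 := G.loopless a
    have h4 : G.Adj a b ↔ G.Adj b a := ⟨G.symm, G.symm⟩
    simp only [mergeInto, Set.mem_singleton_iff]
    grind

theorem XM_mergeInto (G : FGraph α) {S P : Set α} {c w u p₀ : α} (hSV : S ⊆ G.verts)
    (hbip : ∀ a b, G.Adj a b → (a ∈ S ↔ b ∉ S)) (hPS : P ⊆ S) (hcP : c ∈ P)
    (hu : u ∈ S) (huP : u ∉ P) (hp₀ : p₀ ∈ P)
    (hw : ∀ x, G.Adj w x ↔ x = p₀ ∨ x = u)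
    (hunique : ∀ x p, G.Adj u x → p ∈ P → G.Adj p x → x = w) :
    (G.mergeInto S P c).XM w u = G.mergeInto S (insert u P) c := by
  have symm : ∀ x y, G.Adj x y → G.Adj y x := fun x y => G.symm
  have wu : G.Adj w u := (hw u).2 (Or.inr rfl)
  have wp : G.Adj w p₀ := (hw p₀).2 (Or.inl rfl)
  have wS : w ∉ S := fun h => (hbip _ _ wu).1 h hu
  have wV := (G.edge_mem wu).1
  have hcS := hPS hcP
  have hcV := hSV hcS
  have huV := hSV hu
  have hcu : c ≠ u := fun h => huP (h ▸ hcP)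
  have wv : w ∈ (G.mergeInto S P c).verts := by
    refine ⟨wV, Or.inr fun p hp q hq h1 h2 => ?_⟩
    have := (hw p).1 (symm _ _ h1)
    have := (hw q).1 (symm _ _ h2)
    grind
  have hv : ∀ x, (x ∈ (G.mergeInto S P c).verts ∧ x ≠ w) ↔
      x ∈ (G.mergeInto S (insert u P) c).verts := by
    intro x
    simp only [mergeInto, Set.mem_ofPred_eq, Set.mem_insert_iff]
    constructor
    · rintro ⟨⟨h1, h2⟩, h3⟩
      refine ⟨h1, h2.imp_right fun h2 p hp q hq hpx hqx => ?_⟩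
      grind
    · rintro ⟨h1, h2⟩
      refine ⟨⟨h1, h2.imp_right fun h2 p hp q hq hpx hqx => h2 p (.inr hp) q (.inr hq) hpx hqx⟩, ?_⟩
      rintro rfl
      have := h2.resolve_left wS p₀ (.inr hp₀) u (.inl rfl) (symm _ _ wp) (symm _ _ wu)
      exact huP (this ▸ hp₀)
  have hS : ∀ (Q : Set α) x, x ∈ S → x ∈ (G.mergeInto S Q c).verts := fun Q x hx =>
    ⟨hSV hx, Or.inl hx⟩
  have hadj : ∀ (Q : Set α) a b, (G.mergeInto S Q c).Adj a b ↔
      a ∈ (G.mergeInto S Q c).verts ∧ b ∈ (G.mergeInto S Q c).verts ∧ a ≠ b ∧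
    (((a = c ∧ (b ∈ Q ∨ b ∉ S ∧ ∃ p ∈ Q, G.Adj p b)) ∨ (a ∈ S ∧ a ∉ Q ∧ G.Adj a b)) ∨
     ((b = c ∧ (a ∈ Q ∨ a ∉ S ∧ ∃ p ∈ Q, G.Adj p a)) ∨ (b ∈ S ∧ b ∉ Q ∧ G.Adj b a))) :=
    fun _ _ _ => Iff.rfl
  have hPw : ∃ p ∈ P, G.Adj p w := ⟨p₀, hp₀, symm _ _ wp⟩
  have hadju : ∀ x, (G.mergeInto S P c).Adj u x ↔
      x ∈ (G.mergeInto S P c).verts ∧ G.Adj u x := by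
    intro x
    have := hbip u x
    have := hS P u hu
    have := G.loopless u
    rw [hadj]
    grind
  have key := XM_adj_of_degree_two (G.mergeInto S P c) (c := c) (w := w) (u := u)
    (by
      intro x
      have := hS P x
      have := hw x
      rw [hadj]
      grind)
    hcu
    (by
      rw [hadj]
      have := hbip u c
      grind)
    (by
      intro x h1 h2
      rw [hadju] at h2
      rw [hadj] at h1
      have := hbip u x
      grind)
  refine ext_of_iff (fun a => hv a) (fun a b => ?_)
  rw [key, hadju, hadju, hadj, hadj, ← hv, ← hv]
  have e : ∀ x, (∃ p ∈ insert u P, G.Adj p x) ↔ G.Adj u x ∨ ∃ p ∈ P, G.Adj p x := by simp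
  rw [e, e]
  simp only [Set.mem_insert_iff]
  have hb1 := hbip a b
  have hb2 := hbip u a
  have hb3 := hbip u b
  have hb4 := hbip b a
  have hb5 := hbip a u
  have hb6 := hbip b u
  have ha := hS P a
  have hb := hS P b
  have ha' := @hPS a
  have hb' := @hPS b
  have s1 := symm a u
  have s2 := symm b u
  have s3 := symm u a
  have s4 := symm u b
  generalize (∃ p ∈ P, G.Adj p a) = X at *
  generalize (∃ p ∈ P, G.Adj p b) = Y at *
  clear hv hadj hadju key e hbip symm hunique hw hS hPw
  by_cases a = c <;> by_cases b = c <;> by_cases a = u <;> by_cases b = u <;> grind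

end FGraph

/-- The vertices to be merged into one star centre: the even columns of every row congruent to
`1` modulo `4`, together with the odd rows of the column `0`. -/
def combCentres (n : ℕ) : Set (ℕ × ℕ) :=
  {p | p.1 < n ∧ p.2 < n ∧ p.1 % 2 = 1 ∧ p.2 % 2 = 0 ∧ (p.1 % 4 = 1 ∨ p.2 = 0)}

/-- The members of `combCentres n` that precede `(r, s)` lexicographically. -/
def combCentresBefore (n r s : ℕ) : Set (ℕ × ℕ) :=
  {p | p ∈ combCentres n ∧ (p.1 < r ∨ p.1 = r ∧ p.2 < s)}

/-- The vertices of the grid that are neither comb centres nor adjacent to one. -/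
def combDiscarded (n : ℕ) : Set (ℕ × ℕ) :=
  {p | p.1 < n ∧ p.2 < n ∧
    ¬ ((p.1 % 2 = 0 ∧ p.2 % 2 = 0) ∨ p.1 % 4 = 1 ∨ (p.1 % 4 = 3 ∧ p.2 ≤ 1))}

/-- The induced subtree of the grid on the comb centres and their neighbours. -/
def combGraph (n : ℕ) : FGraph (ℕ × ℕ) :=
  (gridGraph n).deleteSet (combDiscarded n)

theorem combDiscarded_finite (n : ℕ) : (combDiscarded n).Finite := by
  refine ((Set.finite_Iio n).prod (Set.finite_Iio n)).subset ?_
  rintro ⟨a, b⟩ ⟨h1, h2, _⟩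
  exact ⟨h1, h2⟩

theorem combGraph_verts {n a b : ℕ} : (a, b) ∈ (combGraph n).verts ↔ a < n ∧ b < n ∧
    ((a % 2 = 0 ∧ b % 2 = 0) ∨ a % 4 = 1 ∨ (a % 4 = 3 ∧ b ≤ 1)) := by
  simp only [combGraph, FGraph.deleteSet, gridGraph, combDiscarded, Set.mem_sdiff,
    Set.mem_ofPred_eq]
  tauto

theorem combGraph_adj {n a b c d : ℕ} : (combGraph n).Adj (a, b) (c, d) ↔
    (a < n ∧ b < n ∧ ((a % 2 = 0 ∧ b % 2 = 0) ∨ a % 4 = 1 ∨ (a % 4 = 3 ∧ b ≤ 1))) ∧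
    (c < n ∧ d < n ∧ ((c % 2 = 0 ∧ d % 2 = 0) ∨ c % 4 = 1 ∨ (c % 4 = 3 ∧ d ≤ 1))) ∧
    ((a = c ∧ (b + 1 = d ∨ d + 1 = b)) ∨ (b = d ∧ (a + 1 = c ∨ c + 1 = a))) := by
  simp only [combGraph, FGraph.deleteSet, gridGraph, combDiscarded, Set.mem_ofPred_eq]
  grind

theorem mem_combCentres {n a b : ℕ} : (a, b) ∈ combCentres n ↔
    a < n ∧ b < n ∧ a % 2 = 1 ∧ b % 2 = 0 ∧ (a % 4 = 1 ∨ b = 0) := Iff.rfl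

theorem mem_combCentresBefore {n r s a b : ℕ} : (a, b) ∈ combCentresBefore n r s ↔
    (a < n ∧ b < n ∧ a % 2 = 1 ∧ b % 2 = 0 ∧ (a % 4 = 1 ∨ b = 0)) ∧
      (a < r ∨ a = r ∧ b < s) := Iff.rfl

theorem combCentres_subset_verts (n : ℕ) : combCentres n ⊆ (combGraph n).verts := by
  rintro ⟨a, b⟩ h
  rw [mem_combCentres] at h
  rw [combGraph_verts]
  omega

theorem combGraph_bipartite (n : ℕ) (p q : ℕ × ℕ) (h : (combGraph n).Adj p q) :
    p ∈ combCentres n ↔ q ∉ combCentres n := by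
  obtain ⟨a, b⟩ := p
  obtain ⟨c, d⟩ := q
  rw [combGraph_adj] at h
  rw [mem_combCentres, mem_combCentres]
  omega

theorem combCentresBefore_eq_insert {n r s : ℕ} (h : (r, s) ∈ combCentres n) :
    combCentresBefore n r (s + 1) = insert (r, s) (combCentresBefore n r s) := by
  ext ⟨a, b⟩
  rw [mem_combCentres] at h
  rw [Set.mem_insert_iff, mem_combCentresBefore, mem_combCentresBefore, Prod.mk.injEq]
  omega

theorem combCentresBefore_eq_of_notMem {n r s : ℕ} (h : (r, s) ∉ combCentres n) :
    combCentresBefore n r (s + 1) = combCentresBefore n r s := by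
  ext ⟨a, b⟩
  rw [mem_combCentres] at h
  rw [mem_combCentresBefore, mem_combCentresBefore]
  constructor
  · rintro ⟨h1, h2⟩
    refine ⟨h1, ?_⟩
    by_contra h3
    obtain ⟨rfl, rfl⟩ : a = r ∧ b = s := by omega
    exact h h1
  · omega

theorem combCentresBefore_row_end (n r : ℕ) :
    combCentresBefore n r n = combCentresBefore n (r + 1) 0 := by
  ext ⟨a, b⟩
  rw [mem_combCentresBefore, mem_combCentresBefore]
  omega

/-- The comb with the centres before `(r, s)` merged into `(1, 0)`. -/
def combMerged (n r s : ℕ) : FGraph (ℕ × ℕ) :=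
  (combGraph n).mergeInto (combCentres n) (combCentresBefore n r s) (1, 0)

theorem combMerged_isVertexMinor_succ {n k r s : ℕ} (hn : n = 4 * k + 3) (hr : 1 ≤ r)
    (hs : r = 1 → 1 ≤ s) :
    FGraph.IsVertexMinor (combMerged n r (s + 1)) (combMerged n r s) := by
  unfold combMerged
  by_cases h : (r, s) ∈ combCentres n
  · rw [combCentresBefore_eq_insert h]
    have h' := mem_combCentres.1 h
    have hsub : combCentresBefore n r s ⊆ combCentres n := fun _ hp => hp.1
    have hcentre : (1, 0) ∈ combCentresBefore n r s := by
      rw [mem_combCentresBefore]; omega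
    have hnot : (r, s) ∉ combCentresBefore n r s := by
      rw [mem_combCentresBefore]; omega
    by_cases h0 : s = 0
    · subst h0
      rw [← (combGraph n).XM_mergeInto (w := (r - 1, 0)) (p₀ := (r - 2, 0))
        (combCentres_subset_verts n) (combGraph_bipartite n) hsub hcentre h hnot]
      · exact FGraph.XM_isVertexMinor _ _ _
      · rw [mem_combCentresBefore]; omega
      · rintro ⟨a, b⟩
        rw [combGraph_adj, Prod.mk.injEq, Prod.mk.injEq]; omega
      · rintro ⟨a, b⟩ ⟨c, d⟩ h1 h2 h3
        rw [combGraph_adj] at h1 h3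
        rw [mem_combCentresBefore] at h2
        rw [Prod.mk.injEq]; omega
    · rw [← (combGraph n).XM_mergeInto (w := (r, s - 1)) (p₀ := (r, s - 2))
        (combCentres_subset_verts n) (combGraph_bipartite n) hsub hcentre h hnot]
      · exact FGraph.XM_isVertexMinor _ _ _
      · rw [mem_combCentresBefore]; omega
      · rintro ⟨a, b⟩
        rw [combGraph_adj, Prod.mk.injEq, Prod.mk.injEq]; omega
      · rintro ⟨a, b⟩ ⟨c, d⟩ h1 h2 h3
        rw [combGraph_adj] at h1 h3
        rw [mem_combCentresBefore] at h2
        rw [Prod.mk.injEq]; omega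
  · rw [combCentresBefore_eq_of_notMem h]
    exact Relation.ReflTransGen.refl

theorem combMerged_isVertexMinor_row {n k r s t : ℕ} (hn : n = 4 * k + 3) (hr : 1 ≤ r)
    (hs : r = 1 → 1 ≤ s) (hst : s ≤ t) :
    FGraph.IsVertexMinor (combMerged n r t) (combMerged n r s) := by
  induction t, hst using Nat.le_induction with
  | base => exact Relation.ReflTransGen.refl
  | succ t hst ih =>
    exact Relation.ReflTransGen.trans ih
      (combMerged_isVertexMinor_succ hn hr fun h => (hs h).trans hst)

theorem combMerged_isVertexMinor {n k r : ℕ} (hn : n = 4 * k + 3) (hr : 2 ≤ r) :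
    FGraph.IsVertexMinor (combMerged n r 0) (combMerged n 1 1) := by
  have hrow : ∀ m, combMerged n m n = combMerged n (m + 1) 0 := fun m => by
    rw [combMerged, combMerged, combCentresBefore_row_end]
  induction r, hr using Nat.le_induction with
  | base =>
    rw [← hrow 1]
    exact combMerged_isVertexMinor_row hn le_rfl (fun _ => le_rfl) (by omega)
  | succ r hr ih =>
    rw [← hrow r]
    exact Relation.ReflTransGen.trans ih
      (combMerged_isVertexMinor_row hn (by omega) (by omega) (Nat.zero_le n))

theorem combMerged_start {n k : ℕ} (hn : n = 4 * k + 3) : combMerged n 1 1 = combGraph n := by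
  have h : combCentresBefore n 1 1 = {(1, 0)} := by
    ext ⟨a, b⟩
    rw [mem_combCentresBefore, Set.mem_singleton_iff, Prod.mk.injEq]
    omega
  rw [combMerged, h]
  exact (combGraph n).mergeInto_singleton (combGraph_bipartite n)

theorem combCentresBefore_last (n : ℕ) : combCentresBefore n n 0 = combCentres n := by
  ext ⟨a, b⟩
  rw [mem_combCentresBefore, mem_combCentres]
  omega

theorem combMerged_last_isStar {n k : ℕ} (hn : n = 4 * k + 3) :
    (combMerged n n 0).IsStar (1, 0) := by
  have hc : (1, 0) ∈ combCentres n := by rw [mem_combCentres]; omega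
  have hnbr : ∀ p ∈ (combGraph n).verts, p ∉ combCentres n →
      ∃ q ∈ combCentres n, (combGraph n).Adj q p := by
    rintro ⟨a, b⟩ h1 h2
    rw [combGraph_verts] at h1
    rw [mem_combCentres] at h2
    by_cases h3 : a % 2 = 1
    · refine ⟨(a, b - 1), ?_, ?_⟩
      · rw [mem_combCentres]; omega
      · rw [combGraph_adj]; omega
    · by_cases h4 : a % 4 = 0
      · refine ⟨(a + 1, b), ?_, ?_⟩
        · rw [mem_combCentres]; omega
        · rw [combGraph_adj]; omega
      · refine ⟨(a - 1, b), ?_, ?_⟩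
        · rw [mem_combCentres]; omega
        · rw [combGraph_adj]; omega
  rw [combMerged, combCentresBefore_last]
  refine ⟨⟨combCentres_subset_verts n hc, Or.inl hc⟩, fun p q => ?_⟩
  have hp := hnbr p
  have hq := hnbr q
  simp only [FGraph.mergeInto, Set.mem_ofPred_eq]
  generalize (∃ s ∈ combCentres n, (combGraph n).Adj s p) = X at *
  generalize (∃ s ∈ combCentres n, (combGraph n).Adj s q) = Y at *
  grind

theorem combMerged_last_verts {n k a b : ℕ} (hn : n = 4 * k + 3) :
    (a, b) ∈ (combMerged n n 0).verts ↔ a < n ∧ b < n ∧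
      ((a % 4 ≠ 3 ∧ b % 2 = 0 ∧ (b = 0 → a % 2 = 0 → a = 0 ∨ a + 1 = n)) ∨
        (a % 4 = 3 ∧ b ≤ 1)) := by
  rw [combMerged, combCentresBefore_last]
  simp only [FGraph.mergeInto, Set.mem_ofPred_eq]
  rw [combGraph_verts, mem_combCentres]
  constructor
  · rintro ⟨h1, h2⟩
    refine ⟨h1.1, h1.2.1, ?_⟩
    by_contra h3
    have h4 := h2.resolve_left (by omega)
    by_cases h5 : b % 2 = 1
    · have := h4 (a, b - 1) (by rw [mem_combCentres]; omega) (a, b + 1)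
        (by rw [mem_combCentres]; omega) (by rw [combGraph_adj]; omega)
        (by rw [combGraph_adj]; omega)
      rw [Prod.mk.injEq] at this
      omega
    · have := h4 (a - 1, b) (by rw [mem_combCentres]; omega) (a + 1, b)
        (by rw [mem_combCentres]; omega) (by rw [combGraph_adj]; omega)
        (by rw [combGraph_adj]; omega)
      rw [Prod.mk.injEq] at this
      omega
  · rintro ⟨h1, h2, h3⟩
    refine ⟨by omega, or_iff_not_imp_left.2 ?_⟩
    rintro h4 ⟨c, d⟩ h5 ⟨e, f⟩ h6 h7 h8
    rw [mem_combCentres] at h5 h6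
    rw [combGraph_adj] at h7 h8
    rw [Prod.mk.injEq]
    omega

/-- Enumerates the vertices of the final star by `k + 1` bands of three rows each; the two
connecting vertices between consecutive bands are traded for the two new vertices in the row
separating them. -/
def combEnum (k : ℕ) (x : ℕ × ℕ × ℕ) : ℕ × ℕ :=
  if x.2.1 = 0 ∧ x.2.2 = 2 ∧ x.1 < k then (4 * x.1 + 3, 0)
  else if x.2.1 = 0 ∧ x.2.2 = 0 ∧ 0 < x.1 then (4 * x.1 - 1, 1)
  else (4 * x.1 + x.2.2, 2 * x.2.1)

theorem combMerged_last_ncard {n k : ℕ} (hn : n = 4 * k + 3) :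
    (combMerged n n 0).verts.ncard = 6 * (k + 1) ^ 2 := by
  let F : Finset (ℕ × ℕ × ℕ) :=
    Finset.range (k + 1) ×ˢ Finset.range (2 * k + 2) ×ˢ Finset.range 3
  have hF : F.card = 6 * (k + 1) ^ 2 := by
    simp only [F, Finset.card_product, Finset.card_range]
    ring
  have hinj : Set.InjOn (combEnum k) F := by
    rintro ⟨j, i, e⟩ h ⟨j', i', e'⟩ h' heq
    simp only [F, Finset.coe_product, Set.mem_prod, Finset.mem_coe, Finset.mem_range] at h h'
    simp only [combEnum] at heq
    simp only [Prod.mk.injEq]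
    split_ifs at heq <;> rw [Prod.mk.injEq] at heq <;> omega
  have himage : (combMerged n n 0).verts = Set.image (combEnum k) F := by
    ext ⟨a, b⟩
    rw [combMerged_last_verts hn]
    simp only [Set.mem_image, Prod.exists, F, Finset.coe_product, Set.mem_prod, Finset.mem_coe,
      Finset.mem_range, combEnum]
    constructor
    · rintro ⟨h1, h2, h3⟩
      by_cases h4 : a % 4 = 3
      · by_cases h5 : b = 0
        · refine ⟨a / 4, 0, 2, by omega, ?_⟩
          rw [if_pos (by omega), Prod.mk.injEq]
          omega
        · refine ⟨a / 4 + 1, 0, 0, by omega, ?_⟩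
          rw [if_neg (by omega), if_pos (by omega), Prod.mk.injEq]
          omega
      · refine ⟨a / 4, b / 2, a % 4, by omega, ?_⟩
        rw [if_neg (by omega), if_neg (by omega), Prod.mk.injEq]
        omega
    · rintro ⟨j, i, e, h, heq⟩
      split_ifs at heq <;> rw [Prod.mk.injEq] at heq <;> omega
  rw [himage, Set.InjOn.ncard_image hinj, Set.ncard_coe_finset, hF]

/-- for `n = 4k + 3` (`k ≥ 0`), the star graph on 6 * (k + 1) ^ 2 vertices is a
vertex-minor of the `n × n` grid graph. -/
theorem grid_star_vertexMinor_15 (k n : ℕ)  (hn : n = 4 * k + 3) :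
    ∃ (H : FGraph (ℕ × ℕ)) (c : ℕ × ℕ),
      FGraph.IsVertexMinor H (gridGraph n) ∧ H.IsStar c ∧
      H.verts.ncard = 6 * (k + 1) ^ 2 := by
  refine ⟨combMerged n n 0, (1, 0), ?_, combMerged_last_isStar hn, combMerged_last_ncard hn⟩
  have h : FGraph.IsVertexMinor (combMerged n n 0) (combGraph n) := by
    rw [← combMerged_start hn]
    exact combMerged_isVertexMinor hn (by omega)
  exact Relation.ReflTransGen.trans
    ((gridGraph n).deleteSet_isVertexMinor (combDiscarded_finite n)) h
end

section
/- For every integer k ≥ 1 and n = 6k, the star graph on (3n² − 2n + 12)/6 = 18k² − 2k + 2 vertices is a vertex-minor of the n×n grid graph. -/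
namespace FGraph

variable {α : Type*}

/-- Deleting a finite set of vertices yields a vertex-minor. -/
theorem exists_delete (G : FGraph α) (S : Finset α) :
    ∃ H : FGraph α, IsVertexMinor H G ∧ H.verts = G.verts \ (S : Set α) ∧
      ∀ a b, H.Adj a b ↔ G.Adj a b ∧ a ∉ S ∧ b ∉ S := by
  classical
  induction S using Finset.induction_on with
  | empty => exact ⟨G, Relation.ReflTransGen.refl, by simp, by simp⟩
  | insert v S _ ih =>
    obtain ⟨H, hH, hv, ha⟩ := ih
    refine ⟨H.ZM v, hH.tail (Step.del H v), ?_, ?_⟩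
    · ext x
      simp only [ZM, hv, Finset.coe_insert, Set.mem_sdiff, Set.mem_singleton_iff,
        Set.mem_insert_iff]
      tauto
    · intro a b
      simp only [ZM, ha, Finset.mem_insert]
      tauto

/-- A star contains every smaller star as a vertex-minor. -/
theorem IsStar.exists_smaller {G : FGraph α} {c : α} (hG : G.IsStar c)
    {m : ℕ} (hm : m + 1 ≤ G.verts.ncard) :
    ∃ H : FGraph α, IsVertexMinor H G ∧ H.IsStar c ∧ H.verts.ncard = m + 1 := by
  classical
  have hfin : G.verts.Finite := Set.finite_of_ncard_pos (by omega)
  have hcard : (G.verts \ {c}).ncard = G.verts.ncard - 1 := Set.ncard_sdiff_singleton_of_mem hG.1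
  obtain ⟨S, hS, hSc⟩ := Set.exists_subset_card_eq
    (s := G.verts \ {c}) (n := G.verts.ncard - (m + 1)) (by omega)
  have hSfin : S.Finite := hfin.subset (hS.trans Set.sdiff_subset)
  obtain ⟨H, hH, hv, ha⟩ := exists_delete G hSfin.toFinset
  rw [Set.Finite.coe_toFinset] at hv
  refine ⟨H, hH, ⟨?_, ?_⟩, ?_⟩
  · rw [hv]
    exact ⟨hG.1, fun h => (hS h).2 rfl⟩
  · intro a b
    rw [ha, hv, hG.2]
    simp only [Set.Finite.mem_toFinset, Set.mem_sdiff]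
    tauto
  · rw [hv, Set.ncard_sdiff (hS.trans Set.sdiff_subset) hSfin]
    omega

/-- Pivoting on the edge `ft` and deleting `t`. -/
def contract (G : FGraph α) (f t : α) : FGraph α :=
  (((G.LC f).LC t).LC f).ZM t

theorem contract_isVertexMinor (G : FGraph α) (f t : α) :
    IsVertexMinor (G.contract f t) G :=
  (((Relation.ReflTransGen.single (Step.lc G f)).tail (Step.lc _ t)).tail
    (Step.lc _ f)).tail (Step.del _ t)

theorem contract_adj (G : FGraph α) {f t q : α} (hfq : f ≠ q) (hnadj : ¬ G.Adj f q)
    (ht : ∀ x, G.Adj t x ↔ x = f ∨ x = q) (a b : α) :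
    (G.contract f t).Adj a b ↔ a ≠ t ∧ b ≠ t ∧
      ((a = f ∧ b = q) ∨ (a = q ∧ b = f) ∨
        (a ≠ f ∧ b ≠ f ∧ a ≠ b ∧
          Xor (G.Adj a b) ((a = q ∧ G.Adj f b) ∨ (b = q ∧ G.Adj f a)))) := by
  have hs : ∀ x y, G.Adj x y ↔ G.Adj y x := fun x y => ⟨G.symm, G.symm⟩
  have hl := G.loopless
  have htf : t ≠ f := fun h => hl t ((ht t).2 (Or.inl h))
  have htq : t ≠ q := fun h => hl t ((ht t).2 (Or.inr h))
  have hft : G.Adj f t := G.symm ((ht f).2 (Or.inl rfl))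
  have hqt : G.Adj q t := G.symm ((ht q).2 (Or.inr rfl))
  simp only [contract, ZM, LC, Xor', Xor]
  by_cases haf : a = f <;> by_cases haq : a = q <;> by_cases hat : a = t <;>
    by_cases hbf : b = f <;> by_cases hbq : b = q <;> by_cases hbt : b = t <;>
    grind

/-- Let `G` be bipartite with sides `F` and `A`. If vertices `t f ∈ A` of degree two
are the edges of a tree on `F` rooted at `r` (with parent map `p` and depth `d`), and all
other vertices of `A` have odd degree, then `G` contracts to a star centred at `r`. -/
theorem exists_star_of_tree (m : ℕ) : ∀ (G : FGraph α) (F A : Finset α) (r : α)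
    (t p : α → α) (d : α → ℕ), F.card = m + 1 → G.verts = (F : Set α) ∪ A →
    Disjoint F A → r ∈ F →
    (∀ a b, G.Adj a b → (a ∈ F ∧ b ∈ A) ∨ (a ∈ A ∧ b ∈ F)) →
    (∀ f ∈ F, f ≠ r → t f ∈ A ∧ p f ∈ F ∧ d (p f) < d f ∧
      ∀ x, G.Adj (t f) x ↔ x = f ∨ x = p f) →
    (∀ a ∈ A, (∀ f ∈ F, f ≠ r → t f ≠ a) → Odd {x | G.Adj a x}.ncard) →
    ∃ H : FGraph α, IsVertexMinor H G ∧ H.IsStar r ∧ H.verts.ncard = A.card + 1 := by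
  classical
  induction m with
  | zero =>
    intro G F A r t p d hF hV hdis hr hbip _ hodd
    obtain ⟨x, rfl⟩ := Finset.card_eq_one.1 hF
    obtain rfl := Finset.mem_singleton.1 hr
    have hrA : r ∉ A := Finset.disjoint_singleton_left.1 hdis
    have hadj : ∀ a ∈ A, G.Adj a r := by
      intro a ha
      obtain ⟨x, hx⟩ := Set.nonempty_of_ncard_ne_zero
        (hodd a ha (fun f hf hfr => absurd (Finset.mem_singleton.1 hf) hfr)).pos.ne'
      have := hbip a x hx
      grind
    refine ⟨G, Relation.ReflTransGen.refl, ⟨by simp [hV], ?_⟩, ?_⟩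
    · intro a b
      have h1 := hbip a b
      have h2 := G.loopless a
      have h3 : G.Adj b a → G.Adj a b := G.symm
      simp only [hV, Set.mem_union, Finset.coe_singleton, Set.mem_singleton_iff, Finset.mem_coe]
      grind
    · rw [hV, ← Finset.coe_union, Set.ncard_coe_finset, Finset.card_union_of_disjoint hdis]
      simp [add_comm]
  | succ m ih =>
    intro G F A r t p d hF hV hdis hr hbip htree hodd
    obtain ⟨f, hfmem, hfmax⟩ := Finset.exists_max_image (F.erase r) d
      (Finset.card_pos.1 (by rw [Finset.card_erase_of_mem hr]; omega))
    obtain ⟨hfr, hfF⟩ := Finset.mem_erase.1 hfmem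
    obtain ⟨htA, hpF, hdp, htadj⟩ := htree f hfF hfr
    have hpf : f ≠ p f := fun h => by rw [← h] at hdp; omega
    have hFA : ∀ x, x ∈ F → x ∉ A := fun x h => Finset.disjoint_left.1 hdis h
    have hnadj : ¬ G.Adj f (p f) := fun h => by
      have := hbip _ _ h
      grind
    have hadj := G.contract_adj hpf hnadj htadj
    have htf : t f ≠ f := fun h => hFA f hfF (h ▸ htA)
    have htp : t f ≠ p f := fun h => hFA _ hpF (h ▸ htA)
    have hleaf : ∀ g ∈ F, g ≠ r → p g ≠ f := by
      intro g hg hgr h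
      have h1 := (htree g hg hgr).2.2.1
      have h2 := hfmax g (Finset.mem_erase.2 ⟨hgr, hg⟩)
      rw [h] at h1
      omega
    have hsymm : ∀ x y, G.Adj x y ↔ G.Adj y x := fun x y => ⟨G.symm, G.symm⟩
    have hbound : ∀ a, {x | G.Adj a x}.Finite := fun a =>
      ((F ∪ A).finite_toSet).subset (fun x hx => by
        have := (G.edge_mem hx).2
        rw [hV] at this
        simpa using this)
    obtain ⟨H, hH, hstar, hcard⟩ := ih (G.contract f (t f)) (F.erase f)
      (insert f (A.erase (t f))) r t p d
      (by rw [Finset.card_erase_of_mem hfF]; omega)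
      (by
        ext x
        simp only [contract, ZM, LC, hV, Set.mem_sdiff, Set.mem_union, Finset.mem_coe,
          Set.mem_singleton_iff, Finset.mem_erase, Finset.mem_insert]
        grind)
      (by
        rw [Finset.disjoint_left]
        grind)
      (Finset.mem_erase.2 ⟨hfr.symm, hr⟩)
      (by
        intro a b h
        rw [hadj, Xor] at h
        have h1 := hbip a b
        have h2 := hbip f b
        have h3 := hbip f a
        simp only [Finset.mem_erase, Finset.mem_insert]
        grind)
      (by
        intro g hg hgr
        obtain ⟨hgf, hgF⟩ := Finset.mem_erase.1 hg
        obtain ⟨h1, h2, h3, h4⟩ := htree g hgF hgr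
        have h5 := hleaf g hgF hgr
        have hne : t g ≠ t f := fun h => by
          have := (h4 f).1 (h ▸ (htadj f).2 (Or.inl rfl))
          grind
        refine ⟨by grind, by grind, h3, fun x => ?_⟩
        rw [hadj, Xor, h4, hsymm f (t g), h4]
        grind)
      (by
        intro a ha hat
        have hrest : a = f ∨ (a ≠ f ∧ a ≠ t f ∧ a ∈ A) := by grind
        rcases hrest with rfl | ⟨haf, hatf, haA⟩
        · have : {x | (G.contract a (t a)).Adj a x} = {p a} := by
            ext x
            simp only [Set.mem_ofPred_eq, Set.mem_singleton_iff, hadj]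
            grind
          rw [this, Set.ncard_singleton]
          exact odd_one
        · have hold := hodd a haA (by grind)
          have hap : a ≠ p f := fun h => hFA _ hpF (h ▸ haA)
          have hnew : ∀ x, (G.contract f (t f)).Adj a x ↔ x ≠ f ∧
              Xor (G.Adj a x) (x = p f ∧ G.Adj a f) := by
            intro x
            have h1 := G.loopless a
            have h2 : ¬ G.Adj a (t f) := fun h => by
              have := hbip _ _ h
              grind
            simp only [hadj, hsymm f a, Xor]
            grind
          by_cases h1 : G.Adj a f
          · by_cases h2 : G.Adj a (p f)
            · have hset : {x | (G.contract f (t f)).Adj a x} =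
                  ({x | G.Adj a x} \ {f}) \ {p f} := by
                ext x
                simp only [Set.mem_ofPred_eq, Set.mem_sdiff, Set.mem_singleton_iff, hnew, Xor]
                grind
              have c1 := Set.ncard_sdiff_singleton_add_one (s := {x | G.Adj a x}) h1 (hbound a)
              have c2 := Set.ncard_sdiff_singleton_add_one (s := {x | G.Adj a x} \ {f})
                (a := p f) ⟨h2, hpf.symm⟩ ((hbound a).sdiff)
              rw [hset]
              grind
            · have hset : {x | (G.contract f (t f)).Adj a x} =
                  insert (p f) ({x | G.Adj a x} \ {f}) := by
                ext x
                simp only [Set.mem_ofPred_eq, Set.mem_sdiff, Set.mem_singleton_iff, hnew, Xor,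
                  Set.mem_insert_iff]
                grind
              have c1 := Set.ncard_sdiff_singleton_add_one (s := {x | G.Adj a x}) h1 (hbound a)
              rw [hset, Set.ncard_insert_of_notMem (fun h => h2 h.1) ((hbound a).sdiff), c1]
              exact hold
          · have hset : {x | (G.contract f (t f)).Adj a x} = {x | G.Adj a x} := by
              ext x
              simp only [Set.mem_ofPred_eq, hnew, Xor]
              grind
            rw [hset]
            exact hold)
    refine ⟨H, Relation.ReflTransGen.trans (G.contract_isVertexMinor f (t f)) hH, hstar, ?_⟩
    rw [hcard, Finset.card_insert_of_notMem (fun h => hFA f hfF (Finset.mem_of_mem_erase h)),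
      Finset.card_erase_add_one htA]

end FGraph

/-- The even cells of the comb formed by row `0` and the columns congruent to `1` mod `3`. -/
def combCells (n : ℕ) : Finset (ℕ × ℕ) :=
  (Finset.range n ×ˢ Finset.range n).filter
    (fun x => (x.1 + x.2) % 2 = 0 ∧ (x.1 = 0 ∨ x.2 % 3 = 1))

/-- The odd cells of the grid. -/
def oddCells (n : ℕ) : Finset (ℕ × ℕ) :=
  (Finset.range n ×ˢ Finset.range n).filter (fun x => (x.1 + x.2) % 2 = 1)

/-- The even cells of the grid outside the comb. -/
def offCombCells (n : ℕ) : Finset (ℕ × ℕ) :=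
  (Finset.range n ×ˢ Finset.range n).filter
    (fun x => (x.1 + x.2) % 2 = 0 ∧ ¬ (x.1 = 0 ∨ x.2 % 3 = 1))

/-- The odd cell joining a comb cell to its parent. -/
def combLink (x : ℕ × ℕ) : ℕ × ℕ :=
  if 2 ≤ x.1 then (x.1 - 1, x.2) else if x.1 = 1 then (1, x.2 - 1)
  else if x.2 % 6 = 2 then (1, x.2) else (0, x.2 - 1)

/-- The parent of a comb cell in the tree rooted at the corner `(0, 0)`. -/
def combParent (x : ℕ × ℕ) : ℕ × ℕ :=
  if 2 ≤ x.1 then (x.1 - 2, x.2) else if x.1 = 1 then (0, x.2 - 1)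
  else if x.2 % 6 = 2 then (1, x.2 - 1) else (0, x.2 - 2)

theorem mem_combCells {n i j : ℕ} : (i, j) ∈ combCells n ↔
    (i < n ∧ j < n) ∧ (i + j) % 2 = 0 ∧ (i = 0 ∨ j % 3 = 1) := by
  simp [combCells]

theorem mem_oddCells {n i j : ℕ} : (i, j) ∈ oddCells n ↔
    (i < n ∧ j < n) ∧ (i + j) % 2 = 1 := by
  simp [oddCells]

theorem mem_offCombCells {n i j : ℕ} : (i, j) ∈ offCombCells n ↔
    (i < n ∧ j < n) ∧ (i + j) % 2 = 0 ∧ ¬ (i = 0 ∨ j % 3 = 1) := by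
  simp [offCombCells]

theorem le_card_oddCells (k : ℕ) : 18 * k ^ 2 ≤ (oddCells (6 * k)).card := by
  have h : (Finset.range (6 * k) ×ˢ Finset.range (3 * k)).card = 18 * k ^ 2 := by
    rw [Finset.card_product, Finset.card_range, Finset.card_range]
    ring
  rw [← h]
  refine Finset.card_le_card_of_injOn (fun x => (x.1, 2 * x.2 + (x.1 + 1) % 2)) ?_ ?_
  · rintro ⟨i, j⟩ hij
    simp only [Finset.coe_product, Finset.coe_range, Set.mem_prod, Set.mem_Iio] at hij
    rw [Finset.mem_coe, mem_oddCells]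
    omega
  · rintro ⟨i, j⟩ _ ⟨i', j'⟩ _ h
    simp only [Prod.mk.injEq] at h ⊢
    omega

/-- Adjacency in the grid restricted to the odd cells and the comb. -/
def CombAdj (n : ℕ) (x y : ℕ × ℕ) : Prop :=
  (gridGraph n).Adj x y ∧ x ∉ offCombCells n ∧ y ∉ offCombCells n

theorem combAdj_iff {n i j a b : ℕ} : CombAdj n (i, j) (a, b) ↔
    (i < n ∧ j < n ∧ a < n ∧ b < n ∧
      ((i = a ∧ (j + 1 = b ∨ b + 1 = j)) ∨ (j = b ∧ (i + 1 = a ∨ a + 1 = i)))) ∧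
    ¬ ((i < n ∧ j < n) ∧ (i + j) % 2 = 0 ∧ ¬ (i = 0 ∨ j % 3 = 1)) ∧
    ¬ ((a < n ∧ b < n) ∧ (a + b) % 2 = 0 ∧ ¬ (a = 0 ∨ b % 3 = 1)) := by
  simp only [CombAdj, gridGraph, mem_offCombCells]

theorem combLink_spec {k : ℕ} {f : ℕ × ℕ} (hf : f ∈ combCells (6 * k)) (hr : f ≠ (0, 0)) :
    combLink f ∈ oddCells (6 * k) ∧ combParent f ∈ combCells (6 * k) ∧
      (combParent f).1 + 3 * (combParent f).2 < f.1 + 3 * f.2 ∧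
      ∀ x, CombAdj (6 * k) (combLink f) x ↔ x = f ∨ x = combParent f := by
  obtain ⟨i, j⟩ := f
  rw [mem_combCells] at hf
  simp only [ne_eq, Prod.mk.injEq] at hr
  simp only [combLink, combParent]
  split_ifs <;>
  · rw [mem_oddCells, mem_combCells]
    refine ⟨by omega, by omega, by omega, ?_⟩
    rintro ⟨a, b⟩
    simp only [combAdj_iff, Prod.mk.injEq]
    omega

theorem odd_ncard_combAdj {k : ℕ} {x : ℕ × ℕ} (hx : x ∈ oddCells (6 * k))
    (hlink : ∀ f ∈ combCells (6 * k), f ≠ (0, 0) → combLink f ≠ x) :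
    Odd {y | CombAdj (6 * k) x y}.ncard := by
  obtain ⟨i, j⟩ := x
  rw [mem_oddCells] at hx
  have single : ∀ u v : ℕ, (∀ a b, CombAdj (6 * k) (i, j) (a, b) ↔ a = u ∧ b = v) →
      Odd {y | CombAdj (6 * k) (i, j) y}.ncard := by
    intro u v h
    have : {y | CombAdj (6 * k) (i, j) y} = {(u, v)} := by
      ext ⟨a, b⟩
      simp [h]
    rw [this, Set.ncard_singleton]
    exact odd_one
  have notLink : ∀ a b : ℕ, (a, b) ∈ combCells (6 * k) → (a, b) ≠ (0, 0) →
      combLink (a, b) = (i, j) → False := fun a b h h' => hlink (a, b) h h'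
  simp only [mem_combCells, ne_eq, Prod.mk.injEq, combLink] at notLink
  by_cases hcol : 1 ≤ i ∧ j % 3 = 1
  · by_cases hend : i + 1 < 6 * k
    · exact (notLink (i + 1) j (by omega) (by omega)
        (by rw [if_pos (by omega)]; rfl)).elim
    · exact single (i - 1) j (by intro a b; rw [combAdj_iff]; omega)
  by_cases hlow : 2 ≤ i
  · by_cases hj : j % 3 = 0
    · exact single i (j + 1) (by intro a b; rw [combAdj_iff]; omega)
    · exact single i (j - 1) (by intro a b; rw [combAdj_iff]; omega)
  by_cases hi : i = 1
  · subst hi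
    by_cases hj : j % 6 = 0
    · exact (notLink 1 (j + 1) (by omega) (by omega) (by simp)).elim
    · have hj2 : j % 6 = 2 := by omega
      exact (notLink 0 j (by omega) (by omega) (by simp [hj2])).elim
  obtain rfl : i = 0 := by omega
  by_cases hj : j % 6 = 1
  · have : {y | CombAdj (6 * k) (0, j) y} = {(0, j - 1), (0, j + 1), (1, j)} := by
      ext ⟨a, b⟩
      simp only [combAdj_iff, Set.mem_ofPred_eq, Set.mem_insert_iff,
        Set.mem_singleton_iff, Prod.mk.injEq]
      omega
    rw [this, Set.ncard_eq_three.2 ⟨_, _, _, ?_, ?_, ?_, rfl⟩]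
    · decide
    all_goals simp only [ne_eq, Prod.mk.injEq]; omega
  by_cases hend : j + 1 < 6 * k
  · refine (notLink 0 (j + 1) (by omega) (by omega) ?_).elim
    rw [if_neg (by omega), if_neg (by omega), if_neg (by omega)]
    rfl
  · exact single 0 (j - 1) (by intro a b; rw [combAdj_iff]; omega)

/-- for `n = 6k` (`k ≥ 1`), the star graph on 18 * k ^ 2 - 2 * k + 2 vertices is a
vertex-minor of the `n × n` grid graph. -/
theorem grid_star_vertexMinor_17 (k n : ℕ) (hk : 1 ≤ k) (hn : n = 6 * k) :
    ∃ (H : FGraph (ℕ × ℕ)) (c : ℕ × ℕ),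
      FGraph.IsVertexMinor H (gridGraph n) ∧ H.IsStar c ∧
      H.verts.ncard = 18 * k ^ 2 - 2 * k + 2 := by
  classical
  subst hn
  obtain ⟨G, hG, hGv, hGa⟩ := FGraph.exists_delete (gridGraph (6 * k)) (offCombCells (6 * k))
  have hroot : ((0, 0) : ℕ × ℕ) ∈ combCells (6 * k) := by
    rw [mem_combCells]
    omega
  have hdis : Disjoint (combCells (6 * k)) (oddCells (6 * k)) := by
    rw [Finset.disjoint_left]
    rintro ⟨i, j⟩
    rw [mem_combCells, mem_oddCells]
    omega
  obtain ⟨S, hS, hstar, hcard⟩ := FGraph.exists_star_of_tree ((combCells (6 * k)).card - 1) G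
    (combCells (6 * k)) (oddCells (6 * k)) (0, 0) combLink combParent
    (fun x => x.1 + 3 * x.2) (by have := Finset.card_pos.2 ⟨_, hroot⟩; omega)
    (by
      ext ⟨i, j⟩
      simp only [hGv, gridGraph, Set.mem_sdiff, Set.mem_ofPred_eq, Set.mem_union, Finset.mem_coe,
        mem_offCombCells, mem_combCells, mem_oddCells]
      omega)
    hdis hroot
    (by
      rintro ⟨i, j⟩ ⟨i', j'⟩ h
      rw [hGa] at h
      simp only [gridGraph, mem_offCombCells] at h
      simp only [mem_combCells, mem_oddCells]
      omega)
    (fun f hf hr => by simpa only [CombAdj, ← hGa] using combLink_spec hf hr)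
    (fun a ha hl => by simpa only [CombAdj, ← hGa] using odd_ncard_combAdj ha hl)
  have hle := le_card_oddCells k
  have hsq : k ≤ k ^ 2 := Nat.le_self_pow two_ne_zero k
  obtain ⟨H, hH, hHstar, hHcard⟩ := hstar.exists_smaller
    (m := 18 * k ^ 2 - 2 * k + 1) (by omega)
  exact ⟨H, (0, 0), (hG.trans hS).trans hH, hHstar, by omega⟩
end
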